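/- Let H be a real inner product space and let 1 < p < 2. Then there exists a constant C_p > 0 such that for all x, y ∈ H with (x, y) ≠ (0, 0), ⟨‖x‖^(p-2)·x − ‖y‖^(p-2)·y, x − y⟩ ≥ C_p·‖x − y‖² / (‖x‖ + ‖y‖)^(2-p). -/

import Mathlib

open RealInnerProductSpace

/-- The power `r ^ (p - 2)` is antitone in `r > 0`, weighted so as to allow `r = 0`. -/
lemma rpow_add_mul_le_rpow_mul {p a b s : ℝ} (hp : p ≤ 2) (ha : 0 ≤ a) (hb : 0 ≤ b)
    (hs : 0 ≤ s) (has : a = 0 → s = 0) : (a + b) ^ (p - 2) * s ≤ a ^ (p - 2) * s := by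
  rcases ha.eq_or_lt with h | h
  · simp [has h.symm]
  · exact mul_le_mul_of_nonneg_right
      (Real.rpow_le_rpow_of_nonpos h (by linarith) (by linarith)) hs

lemma rpow_sub_two_mul_self {p a : ℝ} (hp : p ≠ 1) (ha : 0 ≤ a) :
    a ^ (p - 2) * a = a ^ (p - 1) := by
  have h := Real.rpow_add_one' ha (y := p - 2) (fun h => hp (by linarith))
  rw [← h]
  ring_nf

/-- Bernoulli's inequality in homogeneous form: the tangent line bound for `r ↦ r ^ q`. -/
lemma rpow_le_tangent {q a b : ℝ} (hq0 : 0 ≤ q) (hq1 : q ≤ 1) (ha : 0 < a) (hb : 0 ≤ b) :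
    b ^ q ≤ a ^ q + q * a ^ (q - 1) * (b - a) := by
  have h := rpow_one_add_le_one_add_mul_self (s := b / a - 1)
    (by linarith [div_nonneg hb ha.le]) hq0 hq1
  rw [add_sub_cancel, Real.div_rpow hb ha.le, div_le_iff₀ (Real.rpow_pos_of_pos ha q)] at h
  rw [Real.rpow_sub_one ha.ne']
  refine h.trans_eq ?_
  field_simp

lemma rpow_strong_monotone_of_le {p a b : ℝ} (hp1 : 1 < p) (hp2 : p < 2) (hb : 0 ≤ b)
    (hba : b ≤ a) :
    (p - 1) * (a + b) ^ (p - 2) * (a - b) ^ 2 ≤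
      (a ^ (p - 2) * a - b ^ (p - 2) * b) * (a - b) := by
  have ha := hb.trans hba
  rcases ha.eq_or_lt with h | h
  · obtain rfl : b = 0 := by linarith
    simp [← h]
  · have htangent := rpow_le_tangent (q := p - 1) (by linarith) (by linarith) h hb
    rw [show p - 1 - 1 = p - 2 by ring] at htangent
    have hanti := rpow_add_mul_le_rpow_mul hp2.le ha hb (s := (p - 1) * (a - b) ^ 2)
      (by nlinarith [sq_nonneg (a - b)]) (fun h0 => absurd h0 h.ne')
    rw [rpow_sub_two_mul_self hp1.ne' ha, rpow_sub_two_mul_self hp1.ne' hb]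
    nlinarith [mul_le_mul_of_nonneg_right htangent (sub_nonneg.2 hba)]

lemma rpow_strong_monotone {p a b : ℝ} (hp1 : 1 < p) (hp2 : p < 2) (ha : 0 ≤ a) (hb : 0 ≤ b) :
    (p - 1) * (a + b) ^ (p - 2) * (a - b) ^ 2 ≤
      (a ^ (p - 2) * a - b ^ (p - 2) * b) * (a - b) := by
  rcases le_total b a with h | h
  · exact rpow_strong_monotone_of_le hp1 hp2 hb h
  · have := rpow_strong_monotone_of_le hp1 hp2 ha h
    rw [add_comm b a] at this
    linarith

/-- Strong monotonicity inequality for the map `x ↦ ‖x‖^(p-2) • x` on a real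
inner product space, case `1 < p < 2`. -/
theorem stmt_1 {H : Type*} [NormedAddCommGroup H] [InnerProductSpace ℝ H]
    (p : ℝ) (hp1 : 1 < p) (hp2 : p < 2) :
    ∃ C : ℝ, 0 < C ∧ ∀ x y : H, (x, y) ≠ (0, 0) →
      (⟪(‖x‖ ^ (p - 2)) • x - (‖y‖ ^ (p - 2)) • y, x - y⟫) ≥
        C * ‖x - y‖ ^ 2 / (‖x‖ + ‖y‖) ^ (2 - p) := by
  refine ⟨p - 1, by linarith, fun x y _ => ?_⟩
  have hx := norm_nonneg x
  have hy := norm_nonneg y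
  have hs : 0 ≤ ‖x‖ * ‖y‖ - ⟪x, y⟫ := sub_nonneg.2 (real_inner_le_norm x y)
  have hradial := rpow_strong_monotone hp1 hp2 hx hy
  have hangx := rpow_add_mul_le_rpow_mul hp2.le hx hy hs
    (fun h => by simp [norm_eq_zero.1 h])
  have hangy := rpow_add_mul_le_rpow_mul hp2.le hy hx hs
    (fun h => by simp [norm_eq_zero.1 h])
  rw [add_comm ‖y‖ ‖x‖] at hangy
  have hslack : 0 ≤ (2 - p) * ((‖x‖ + ‖y‖) ^ (p - 2) * (‖x‖ * ‖y‖ - ⟪x, y⟫)) :=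
    mul_nonneg (by linarith) (mul_nonneg (by positivity) hs)
  rw [ge_iff_le, div_eq_mul_inv, ← Real.rpow_neg (add_nonneg hx hy), neg_sub,
    norm_sub_sq_real]
  simp only [inner_sub_left, inner_sub_right, real_inner_smul_left,
    real_inner_self_eq_norm_sq, real_inner_comm x y]
  linarith
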